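/- arXiv:1605.00078 — 3 statements merged into one kernel-verified Lean document; each statement's English description precedes it below -/
import Mathlib

section
/- Let α, β > 1 and let (x_k)_{k≥1} and (y_k)_{k≥1} be strictly decreasing sequences of positive real numbers converging to 0 such that x_k − x_{k+1} ≃ x_k^α and y_k − y_{k+1} ≃ y_k^β as k → ∞. Then y_k ≃ x_k^γ as k → ∞, where γ = (α − 1)/(β − 1); that is, the points (x_k, y_k) lie, up to multiplicative constants, on the curve y = x^γ. -/
open MeasureTheory Filter Metric Set Topology

noncomputable def lowerBoxDim {X : Type*} [PseudoEMetricSpace X] [MeasurableSpace X]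
    (μ : Measure X) (N : ℝ) (A : Set X) : ℝ :=
  sInf {s : ℝ | 0 < s ∧
    Filter.liminf (fun ε : ℝ => (μ (Metric.thickening ε A)).toReal / ε ^ (N - s)) (𝓝[>] (0:ℝ)) = 0}

noncomputable def upperBoxDim {X : Type*} [PseudoEMetricSpace X] [MeasurableSpace X]
    (μ : Measure X) (N : ℝ) (A : Set X) : ℝ :=
  sInf {s : ℝ | 0 < s ∧
    Filter.limsup (fun ε : ℝ => (μ (Metric.thickening ε A)).toReal / ε ^ (N - s)) (𝓝[>] (0:ℝ)) = 0}

/-- `A` has box dimension `d` (as a subset of an `N`-dimensional ambient space with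
volume measure `μ`): the lower and upper box dimensions coincide and equal `d`. -/
def HasBoxDim {X : Type*} [PseudoEMetricSpace X] [MeasurableSpace X]
    (μ : Measure X) (N : ℝ) (A : Set X) (d : ℝ) : Prop :=
  lowerBoxDim μ N A = d ∧ upperBoxDim μ N A = d

/-- Two positive sequences are comparable: `c * b k ≤ a k ≤ C * b k` eventually. -/
def EvComparable (a b : ℕ → ℝ) : Prop :=
  ∃ c C : ℝ, 0 < c ∧ c ≤ C ∧ ∀ᶠ k in Filter.atTop, c * b k ≤ a k ∧ a k ≤ C * b k

/-- `φ` is a time-1 map of the planar vector field `F` on the neighborhood `U` of the origin. -/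
def IsTime1Map (F : ℝ × ℝ → ℝ × ℝ) (U : Set (ℝ × ℝ)) (φ : ℝ × ℝ → ℝ × ℝ) : Prop :=
  ∀ p ∈ U, ∃ γ : ℝ → ℝ × ℝ, γ 0 = p ∧
    (∀ t ∈ Set.Icc (0:ℝ) 1, HasDerivAt γ (F (γ t)) t) ∧ φ p = γ 1

namespace EvComparable

theorem symm {a b : ℕ → ℝ} (h : EvComparable a b) : EvComparable b a := by
  obtain ⟨c, C, hc, hcC, h⟩ := h
  have hC : 0 < C := hc.trans_le hcC
  refine ⟨C⁻¹, c⁻¹, inv_pos.2 hC, inv_anti₀ hc hcC, ?_⟩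
  filter_upwards [h] with k hk
  exact ⟨(inv_mul_le_iff₀ hC).2 hk.2, (le_inv_mul_iff₀ hc).2 hk.1⟩

theorem trans {a b d : ℕ → ℝ} (h : EvComparable a b) (h' : EvComparable b d) :
    EvComparable a d := by
  obtain ⟨c, C, hc, hcC, h⟩ := h
  obtain ⟨c', C', hc', hcC', h'⟩ := h'
  have hC : 0 < C := hc.trans_le hcC
  refine ⟨c * c', C * C', mul_pos hc hc', mul_le_mul hcC hcC' hc'.le hC.le, ?_⟩
  filter_upwards [h, h'] with k hk hk'
  rw [mul_assoc, mul_assoc]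
  exact ⟨(mul_le_mul_of_nonneg_left hk'.1 hc.le).trans hk.1,
    hk.2.trans (mul_le_mul_of_nonneg_left hk'.2 hC.le)⟩

theorem rpow_of_nonpos {a b : ℕ → ℝ} {p : ℝ} (h : EvComparable a b) (ha : ∀ k, 0 < a k)
    (hb : ∀ k, 0 < b k) (hp : p ≤ 0) :
    EvComparable (fun k => a k ^ p) (fun k => b k ^ p) := by
  obtain ⟨c, C, hc, hcC, h⟩ := h
  have hC : 0 < C := hc.trans_le hcC
  refine ⟨C ^ p, c ^ p, Real.rpow_pos_of_pos hC p, Real.rpow_le_rpow_of_nonpos hc hcC hp, ?_⟩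
  filter_upwards [h] with k hk
  rw [← Real.mul_rpow hC.le (hb k).le, ← Real.mul_rpow hc.le (hb k).le]
  exact ⟨Real.rpow_le_rpow_of_nonpos (ha k) hk.2 hp,
    Real.rpow_le_rpow_of_nonpos (mul_pos hc (hb k)) hk.1 hp⟩

/-- A positive sequence whose increments are eventually bounded between positive constants
grows linearly. -/
theorem natCast_of_increments {u : ℕ → ℝ} {m M : ℝ} (hu : ∀ k, 0 < u k) (hm : 0 < m)
    (hmM : m ≤ M) (h : ∀ᶠ k in atTop, m ≤ u (k + 1) - u k ∧ u (k + 1) - u k ≤ M) :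
    EvComparable u (fun k => (k : ℝ)) := by
  obtain ⟨N, hN⟩ := eventually_atTop.1 h
  have key : ∀ j : ℕ, u N + m * j ≤ u (N + j) ∧ u (N + j) ≤ u N + M * j := by
    intro j
    induction j with
    | zero => simp
    | succ j ih =>
      have := hN (N + j) (Nat.le_add_right _ _)
      rw [← add_assoc]
      push_cast
      constructor <;> linarith
  have huN := hu N
  refine ⟨m / 2, u N + M, half_pos hm, by linarith, ?_⟩
  filter_upwards [eventually_ge_atTop (2 * N + 1)] with k hk
  obtain ⟨j, rfl⟩ := Nat.exists_eq_add_of_le (show N ≤ k by omega)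
  have hj : (N : ℝ) + 1 ≤ j := by exact_mod_cast (show N + 1 ≤ j by omega)
  have hN0 : (0 : ℝ) ≤ N := N.cast_nonneg
  obtain ⟨h1, h2⟩ := key j
  push_cast
  constructor <;> nlinarith

end EvComparable

theorem mul_one_sub_le_rpow_neg_sub_one {s w : ℝ} (hs : 0 ≤ s) (hw : 0 < w) :
    s * (1 - w) ≤ w ^ (-s) - 1 := by
  have h1 := Real.add_one_le_exp (Real.log w * -s)
  have h2 := mul_le_mul_of_nonneg_left (Real.log_le_sub_one_of_pos hw) hs
  rw [Real.rpow_def_of_pos hw]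
  linarith

theorem rpow_neg_sub_one_le_mul_one_sub {s w : ℝ} (hs : 0 ≤ s) (hw : 1 / 2 ≤ w) (hw1 : w ≤ 1) :
    w ^ (-s) - 1 ≤ (1 / 2 : ℝ) ^ (-s) * (2 * s) * (1 - w) := by
  have hw0 : 0 < w := by linarith
  have h1 : 1 + s * Real.log w ≤ w ^ s := by
    rw [Real.rpow_def_of_pos hw0]
    linarith [Real.add_one_le_exp (Real.log w * s)]
  have h2 : -(2 * (1 - w)) ≤ Real.log w := by
    refine le_trans ?_ (Real.one_sub_inv_le_log_of_pos hw0)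
    have : w⁻¹ * w = 1 := inv_mul_cancel₀ hw0.ne'
    have : w⁻¹ ≤ 2 := by simpa using inv_anti₀ (by norm_num) hw
    nlinarith
  have h3 : 1 - w ^ s ≤ 2 * s * (1 - w) := by
    linarith [mul_le_mul_of_nonneg_left h2 hs]
  have h4 : w ^ (-s) * w ^ s = 1 := by rw [← Real.rpow_add hw0]; simp
  calc w ^ (-s) - 1 = w ^ (-s) * (1 - w ^ s) := by rw [mul_sub, h4, mul_one]
    _ ≤ w ^ (-s) * (2 * s * (1 - w)) :=
      mul_le_mul_of_nonneg_left h3 (Real.rpow_nonneg hw0.le _)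
    _ ≤ (1 / 2 : ℝ) ^ (-s) * (2 * s * (1 - w)) := by
      refine mul_le_mul_of_nonneg_right
        (Real.rpow_le_rpow_of_nonpos (by norm_num) hw (by linarith)) ?_
      exact mul_nonneg (by positivity) (by linarith)
    _ = _ := by ring

/-- If `z k - z (k + 1)` is comparable to `z k ^ a` with `1 < a`, then `z k ^ (-(a - 1))` is
comparable to `k`. -/
theorem evComparable_rpow_neg_natCast {a : ℝ} (ha : 1 < a) {z : ℕ → ℝ} (hz : ∀ k, 0 < z k)
    (hlim : Tendsto z atTop (𝓝 0))
    (h : EvComparable (fun k => z k - z (k + 1)) (fun k => z k ^ a)) :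
    EvComparable (fun k => z k ^ (-(a - 1))) (fun k => (k : ℝ)) := by
  obtain ⟨c, C, hc, hcC, h⟩ := h
  obtain ⟨s, rfl⟩ : ∃ s, a = s + 1 := ⟨a - 1, by ring⟩
  have hs : 0 < s := by linarith
  rw [add_sub_cancel_right]
  have hsmall : ∀ᶠ k in atTop, C * z k ^ s ≤ 1 / 2 := by
    have ht : Tendsto (fun k => C * z k ^ s) atTop (𝓝 0) := by
      simpa [Real.zero_rpow hs.ne'] using
        (hlim.rpow_const (p := s) (Or.inr hs.le)).const_mul C
    exact ht.eventually_le_const (by norm_num)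
  have hK : 0 < (1 / 2 : ℝ) ^ (-s) := by positivity
  have hK1 : 1 ≤ (1 / 2 : ℝ) ^ (-s) :=
    Real.one_le_rpow_of_pos_of_le_one_of_nonpos (by norm_num) (by norm_num) (by linarith)
  refine EvComparable.natCast_of_increments (m := s * c)
    (M := (1 / 2 : ℝ) ^ (-s) * (2 * s) * C) (fun k => Real.rpow_pos_of_pos (hz k) _)
    (mul_pos hs hc) ?_ ?_
  · refine mul_le_mul ?_ hcC hc.le (by positivity)
    nlinarith
  · filter_upwards [h, hsmall] with k hk hk'
    obtain ⟨w, hw⟩ : ∃ w, w = z (k + 1) / z k := ⟨_, rfl⟩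
    have hzk := hz k
    have hw0 : 0 < w := hw ▸ div_pos (hz _) hzk
    have hzw : z (k + 1) = z k * w := by rw [hw]; field_simp
    have hzs : 0 < z k ^ s := Real.rpow_pos_of_pos hzk s
    simp only [Real.rpow_add_one hzk.ne', hzw] at hk
    have hl : c * z k ^ s ≤ 1 - w := le_of_mul_le_mul_right (by linarith) hzk
    have hr : 1 - w ≤ C * z k ^ s := le_of_mul_le_mul_right (by linarith) hzk
    have hw1 : w ≤ 1 := by linarith [mul_pos hc hzs]
    have hlow := mul_one_sub_le_rpow_neg_sub_one hs.le hw0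
    have hup := rpow_neg_sub_one_le_mul_one_sub hs.le (by linarith) hw1
    have hinc : z (k + 1) ^ (-s) - z k ^ (-s) = (w ^ (-s) - 1) / z k ^ s := by
      rw [hzw, Real.mul_rpow hzk.le hw0.le, Real.rpow_neg hzk.le]
      ring
    rw [hinc, le_div_iff₀ hzs, div_le_iff₀ hzs]
    constructor
    · linarith [mul_le_mul_of_nonneg_left hl hs.le]
    · have : 0 ≤ (1 / 2 : ℝ) ^ (-s) * (2 * s) := by positivity
      linarith [mul_le_mul_of_nonneg_left hr this]

/-- The orbit lies on the curve `y = x ^ ((α-1)/(β-1))` up to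
multiplicative constants. -/
theorem orbit_lies_on_power_curve
    (α β : ℝ) (hα : 1 < α) (hβ : 1 < β)
    (x y : ℕ → ℝ)
    (hxpos : ∀ k, 0 < x k) (hypos : ∀ k, 0 < y k)
    (hxanti : StrictAnti x) (hyanti : StrictAnti y)
    (hxlim : Tendsto x atTop (𝓝 0)) (hylim : Tendsto y atTop (𝓝 0))
    (hxasym : EvComparable (fun k => x k - x (k+1)) (fun k => x k ^ α))
    (hyasym : EvComparable (fun k => y k - y (k+1)) (fun k => y k ^ β)) :
    EvComparable y (fun k => x k ^ ((α - 1) / (β - 1))) := by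
  have hx := evComparable_rpow_neg_natCast hα hxpos hxlim hxasym
  have hy := evComparable_rpow_neg_natCast hβ hypos hylim hyasym
  have hβ' : β - 1 ≠ 0 := by linarith
  have h := (hy.trans hx.symm).rpow_of_nonpos (p := -(1 / (β - 1)))
    (fun k => Real.rpow_pos_of_pos (hypos k) _) (fun k => Real.rpow_pos_of_pos (hxpos k) _)
    (neg_nonpos.2 (one_div_nonneg.2 (by linarith)))
  convert h using 2 with k k
  · rw [← Real.rpow_mul (hypos k).le, neg_mul_neg, mul_one_div_cancel hβ', Real.rpow_one]
  · rw [← Real.rpow_mul (hxpos k).le, neg_mul_neg, mul_one_div]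
end

section
/- Consider the planar vector field F(x, y) = (y, a x^m + b x^n y + y² B(x, y) + h₁(x) + y h₂(x)) with a ≠ 0, b ≠ 0, m, n ∈ ℕ, m ≥ 2, n ≥ 1, and m < n + 1, where B is smooth with |B(x, y)| ≤ C₀‖(x, y)‖^{max{m, n+1} − 1} near the origin and h₁, h₂ are smooth with |h₁(x)| ≤ C₀|x|^{m+1} and |h₂(x)| ≤ C₀|x|^{n+1} near 0. Let φ = (φ₁, φ₂) be a time-1 map of F on a neighborhood U of the origin. Then there exist real constants c₁, …, c_m, d₁, …, d_m and C, δ > 0 such that for all ‖(x, y)‖ < δ: |φ₁(x, y) − (x + y + (a/2)x^m + a·Σ_{i=1}^{m} c_i x^{m−i} y^i)| ≤ C‖(x, y)‖^{m+1} and |φ₂(x, y) − (y + a x^m + a·Σ_{i=1}^{m} d_i x^{m−i} y^i)| ≤ C‖(x, y)‖^{m+1}. -/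
open MeasureTheory Filter Metric Set Topology

lemma abs_le_of_abs_deriv_le_unit {f f' : ℝ → ℝ} {C : ℝ} (h0 : f 0 = 0)
    (hf : ∀ t ∈ Icc (0 : ℝ) 1, HasDerivAt f (f' t) t)
    (hC : ∀ t ∈ Icc (0 : ℝ) 1, |f' t| ≤ C) :
    ∀ t ∈ Icc (0 : ℝ) 1, |f t| ≤ C := by
  intro t ht
  have h := (convex_Icc (0 : ℝ) 1).norm_image_sub_le_of_norm_hasDerivWithin_le
    (fun s hs => (hf s hs).hasDerivWithinAt) (fun s hs => (Real.norm_eq_abs _).trans_le (hC s hs))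
    (left_mem_Icc.2 zero_le_one) ht
  have hC0 : 0 ≤ C := (abs_nonneg _).trans (hC t ht)
  rw [h0, sub_zero, sub_zero, Real.norm_eq_abs, Real.norm_eq_abs, abs_of_nonneg ht.1] at h
  exact h.trans (mul_le_of_le_one_right hC0 ht.2)

/-- A curve whose velocity is bounded by `L * ‖γ‖` as long as it stays in the ball of radius `δ`
does not leave that ball before time `1` if it starts close enough to the origin. -/
lemma norm_le_exp_mul_of_norm_deriv_le_near {E : Type*} [NormedAddCommGroup E] [NormedSpace ℝ E]
    {F : E → E} {γ : ℝ → E} {L δ : ℝ} (hL : 0 ≤ L)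
    (hF : ∀ q, ‖q‖ < δ → ‖F q‖ ≤ L * ‖q‖)
    (hγ : ∀ t ∈ Icc (0 : ℝ) 1, HasDerivAt γ (F (γ t)) t)
    (h0 : Real.exp (L + 1) * ‖γ 0‖ < δ) :
    ∀ t ∈ Icc (0 : ℝ) 1, ‖γ t‖ ≤ Real.exp (L + 1) * ‖γ 0‖ := by
  have strict : ∀ ρ, ‖γ 0‖ < ρ → Real.exp (L + 1) * ρ < δ →
      ∀ t ∈ Icc (0 : ℝ) 1, ‖γ t‖ ≤ Real.exp (L + 1) * ρ := by
    intro ρ hρ hρδ t ht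
    have hρ0 : 0 < ρ := (norm_nonneg _).trans_lt hρ
    have hexp : ∀ s ≤ (1 : ℝ), ρ * Real.exp ((L + 1) * s) ≤ Real.exp (L + 1) * ρ := by
      intro s hs
      rw [mul_comm]
      gcongr
      nlinarith
    have hB : ∀ s, HasDerivAt (fun s => ρ * Real.exp ((L + 1) * s))
        (ρ * (Real.exp ((L + 1) * s) * (L + 1))) s := by
      intro s
      have h := ((((hasDerivAt_id s).const_mul (L + 1)).exp).const_mul ρ)
      simpa using h
    have key := image_norm_le_of_norm_deriv_right_lt_deriv_boundary (a := 0) (b := 1)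
      (f := γ) (f' := fun s => F (γ s))
      (fun s hs => (hγ s hs).continuousAt.continuousWithinAt)
      (fun s hs => (hγ s ⟨hs.1, hs.2.le⟩).hasDerivWithinAt)
      (B := fun s => ρ * Real.exp ((L + 1) * s))
      (B' := fun s => ρ * (Real.exp ((L + 1) * s) * (L + 1)))
      (by simpa using hρ.le) hB
      (by
        intro s hs heq
        have h1 : ‖F (γ s)‖ ≤ L * ‖γ s‖ := hF _ (by
          rw [heq]; exact (hexp s hs.2.le).trans_lt hρδ)
        have h2 : 0 < ρ * Real.exp ((L + 1) * s) := by positivity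
        rw [heq] at h1
        nlinarith)
      ht
    exact key.trans (hexp t ht.2)
  intro t ht
  have hlim : Tendsto (fun ρ : ℝ => Real.exp (L + 1) * ρ) (𝓝[>] ‖γ 0‖)
      (𝓝 (Real.exp (L + 1) * ‖γ 0‖)) :=
    ((continuous_const.mul continuous_id).tendsto _).mono_left nhdsWithin_le_nhds
  refine ge_of_tendsto hlim ?_
  filter_upwards [self_mem_nhdsWithin, hlim.eventually_lt_const h0] with ρ hρ hρδ
  exact strict ρ hρ hρδ t ht

/-- The primitive of `t ↦ (x + t * y) ^ m` vanishing at `0`. -/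
noncomputable def linePowPrimitive (m : ℕ) (x y t : ℝ) : ℝ :=
  ∑ i ∈ Finset.range (m + 1), (m.choose i : ℝ) / (i + 1) * t ^ (i + 1) * x ^ (m - i) * y ^ i

/-- The second primitive of `t ↦ (x + t * y) ^ m` vanishing to second order at `0`. -/
noncomputable def linePowSecondPrimitive (m : ℕ) (x y t : ℝ) : ℝ :=
  ∑ i ∈ Finset.range (m + 1),
    (m.choose i : ℝ) / ((i + 1) * (i + 2)) * t ^ (i + 2) * x ^ (m - i) * y ^ i

lemma hasDerivAt_linePowPrimitive (m : ℕ) (x y t : ℝ) :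
    HasDerivAt (linePowPrimitive m x y) ((x + t * y) ^ m) t := by
  have h : HasDerivAt (linePowPrimitive m x y) (∑ i ∈ Finset.range (m + 1),
      (m.choose i : ℝ) / (i + 1) * (((i + 1 : ℕ) : ℝ) * t ^ i) * x ^ (m - i) * y ^ i) t := by
    refine HasDerivAt.fun_sum fun i _ => ?_
    exact (((hasDerivAt_pow (i + 1) t).const_mul _).mul_const _).mul_const _
  convert h using 1
  rw [add_comm x, add_pow]
  refine Finset.sum_congr rfl fun i _ => ?_
  have : (i : ℝ) + 1 ≠ 0 := by positivity
  rw [mul_pow]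
  push_cast
  field_simp

lemma hasDerivAt_linePowSecondPrimitive (m : ℕ) (x y t : ℝ) :
    HasDerivAt (linePowSecondPrimitive m x y) (linePowPrimitive m x y t) t := by
  have h : HasDerivAt (linePowSecondPrimitive m x y) (∑ i ∈ Finset.range (m + 1),
      (m.choose i : ℝ) / ((i + 1) * (i + 2)) * (((i + 2 : ℕ) : ℝ) * t ^ (i + 1)) *
        x ^ (m - i) * y ^ i) t := by
    refine HasDerivAt.fun_sum fun i _ => ?_
    exact (((hasDerivAt_pow (i + 2) t).const_mul _).mul_const _).mul_const _
  convert h using 1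
  refine Finset.sum_congr rfl fun i _ => ?_
  have : (i : ℝ) + 1 ≠ 0 := by positivity
  have : (i : ℝ) + 2 ≠ 0 := by positivity
  push_cast
  field_simp

lemma linePowPrimitive_zero (m : ℕ) (x y : ℝ) : linePowPrimitive m x y 0 = 0 := by
  simp [linePowPrimitive]

lemma linePowSecondPrimitive_zero (m : ℕ) (x y : ℝ) : linePowSecondPrimitive m x y 0 = 0 := by
  simp [linePowSecondPrimitive]

lemma sum_range_succ_eq_add_sum_Icc (m : ℕ) (f : ℕ → ℝ) :
    ∑ i ∈ Finset.range (m + 1), f i = f 0 + ∑ i ∈ Finset.Icc 1 m, f i := by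
  rw [Finset.range_eq_Ico, Finset.sum_eq_sum_Ico_succ_bot (Nat.succ_pos m)]
  rfl

lemma linePowPrimitive_one (m : ℕ) (x y : ℝ) :
    linePowPrimitive m x y 1 = x ^ m +
      ∑ i ∈ Finset.Icc 1 m, (m.choose i : ℝ) / (i + 1) * x ^ (m - i) * y ^ i := by
  rw [linePowPrimitive, sum_range_succ_eq_add_sum_Icc]
  simp

lemma linePowSecondPrimitive_one (m : ℕ) (x y : ℝ) :
    linePowSecondPrimitive m x y 1 = x ^ m / 2 +
      ∑ i ∈ Finset.Icc 1 m, (m.choose i : ℝ) / ((i + 1) * (i + 2)) * x ^ (m - i) * y ^ i := by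
  rw [linePowSecondPrimitive, sum_range_succ_eq_add_sum_Icc]
  simp
  ring

lemma nilpotent_curve_expansion {a K R : ℝ} {m : ℕ} (hm : 2 ≤ m) (hK : 0 ≤ K) (hR0 : 0 ≤ R)
    (hR1 : R ≤ 1) {u v g : ℝ → ℝ}
    (hu : ∀ t ∈ Icc (0 : ℝ) 1, HasDerivAt u (v t) t)
    (hv : ∀ t ∈ Icc (0 : ℝ) 1, HasDerivAt v (a * u t ^ m + g t) t)
    (huR : ∀ t ∈ Icc (0 : ℝ) 1, |u t| ≤ R) (hvR : ∀ t ∈ Icc (0 : ℝ) 1, |v t| ≤ R)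
    (hg : ∀ t ∈ Icc (0 : ℝ) 1, |g t| ≤ K * R ^ (m + 1)) :
    |u 1 - (u 0 + v 0 + a * linePowSecondPrimitive m (u 0) (v 0) 1)| ≤
        (|a| * ((|a| + K) * m * 2 ^ (m - 1)) + K) * R ^ (m + 1) ∧
      |v 1 - (v 0 + a * linePowPrimitive m (u 0) (v 0) 1)| ≤
        (|a| * ((|a| + K) * m * 2 ^ (m - 1)) + K) * R ^ (m + 1) := by
  have h0 : (0 : ℝ) ∈ Icc (0 : ℝ) 1 := by simp
  have h1 : (1 : ℝ) ∈ Icc (0 : ℝ) 1 := by simp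
  have hv_first : ∀ t ∈ Icc (0 : ℝ) 1, |v t - v 0| ≤ (|a| + K) * R ^ m := by
    refine abs_le_of_abs_deriv_le_unit (by simp) (fun t ht => (hv t ht).sub_const _) ?_
    intro t ht
    have e1 : |a * u t ^ m| ≤ |a| * R ^ m := by
      rw [abs_mul, abs_pow]
      gcongr
      exact huR t ht
    have e2 : K * R ^ (m + 1) ≤ K * R ^ m := by
      gcongr K * ?_
      exact pow_le_pow_of_le_one hR0 hR1 (Nat.le_succ m)
    calc |a * u t ^ m + g t| ≤ |a * u t ^ m| + |g t| := abs_add_le _ _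
      _ ≤ (|a| + K) * R ^ m := by linarith [hg t ht]
  have hu_first : ∀ t ∈ Icc (0 : ℝ) 1, |u t - (u 0 + t * v 0)| ≤ (|a| + K) * R ^ m := by
    refine abs_le_of_abs_deriv_le_unit (f' := fun t => v t - v 0) (by simp) (fun t ht => ?_)
      hv_first
    simpa using (hu t ht).fun_sub (((hasDerivAt_id t).mul_const (v 0)).const_add (u 0))
  have hpow : ∀ t ∈ Icc (0 : ℝ) 1,
      |u t ^ m - (u 0 + t * v 0) ^ m| ≤ (|a| + K) * m * 2 ^ (m - 1) * R ^ (m + 1) := by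
    intro t ht
    have e1 : |u 0 + t * v 0| ≤ 2 * R := by
      have : |t * v 0| ≤ 1 * R := by
        rw [abs_mul]
        gcongr
        · rw [abs_of_nonneg ht.1]; exact ht.2
        · exact hvR 0 h0
      linarith [abs_add_le (u 0) (t * v 0), huR 0 h0]
    have e2 : max |u t| |u 0 + t * v 0| ≤ 2 * R := max_le (by linarith [huR t ht]) e1
    have e3 : R ^ m * R ^ (m - 1) ≤ R ^ (m + 1) := by
      rw [← pow_add]
      exact pow_le_pow_of_le_one hR0 hR1 (by omega)
    calc |u t ^ m - (u 0 + t * v 0) ^ m|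
        ≤ |u t - (u 0 + t * v 0)| * m * max |u t| |u 0 + t * v 0| ^ (m - 1) :=
          abs_pow_sub_pow_le _ _ _
      _ ≤ (|a| + K) * R ^ m * m * (2 * R) ^ (m - 1) := by
          gcongr
          exact hu_first t ht
      _ = (|a| + K) * m * 2 ^ (m - 1) * (R ^ m * R ^ (m - 1)) := by rw [mul_pow]; ring
      _ ≤ _ := by gcongr
  have hv_second : ∀ t ∈ Icc (0 : ℝ) 1,
      |v t - (v 0 + a * linePowPrimitive m (u 0) (v 0) t)| ≤
        (|a| * ((|a| + K) * m * 2 ^ (m - 1)) + K) * R ^ (m + 1) := by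
    refine abs_le_of_abs_deriv_le_unit
      (f' := fun t => a * u t ^ m + g t - a * (u 0 + t * v 0) ^ m)
      (by simp [linePowPrimitive_zero])
      (fun t ht => (hv t ht).sub
        (((hasDerivAt_linePowPrimitive m (u 0) (v 0) t).const_mul a).const_add _)) ?_
    intro t ht
    calc |a * u t ^ m + g t - a * (u 0 + t * v 0) ^ m|
        = |a * (u t ^ m - (u 0 + t * v 0) ^ m) + g t| := by congr 1; ring
      _ ≤ |a| * |u t ^ m - (u 0 + t * v 0) ^ m| + |g t| := by
          rw [← abs_mul]; exact abs_add_le _ _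
      _ ≤ |a| * ((|a| + K) * m * 2 ^ (m - 1) * R ^ (m + 1)) + K * R ^ (m + 1) := by
          gcongr
          · exact hpow t ht
          · exact hg t ht
      _ = _ := by ring
  refine ⟨?_, hv_second 1 h1⟩
  have hu_second : ∀ t ∈ Icc (0 : ℝ) 1,
      |u t - (u 0 + t * v 0 + a * linePowSecondPrimitive m (u 0) (v 0) t)| ≤
        (|a| * ((|a| + K) * m * 2 ^ (m - 1)) + K) * R ^ (m + 1) := by
    refine abs_le_of_abs_deriv_le_unit
      (f' := fun t => v t - (v 0 + a * linePowPrimitive m (u 0) (v 0) t))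
      (by simp [linePowSecondPrimitive_zero]) (fun t ht => ?_) hv_second
    simpa using (hu t ht).fun_sub ((((hasDerivAt_id t).mul_const (v 0)).const_add (u 0)).fun_add
      ((hasDerivAt_linePowSecondPrimitive m (u 0) (v 0) t).const_mul a))
  simpa using hu_second 1 h1

lemma nilpotent_perturbation_bound {b C₀ : ℝ} {m n : ℕ} (hmn : m < n + 1)
    {B : ℝ → ℝ → ℝ} {h₁ h₂ : ℝ → ℝ}
    (hBbd : ∃ δ₀ > (0:ℝ), ∀ x y : ℝ, ‖((x, y) : ℝ × ℝ)‖ < δ₀ →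
      |B x y| ≤ C₀ * ‖((x, y) : ℝ × ℝ)‖ ^ (max m (n + 1) - 1))
    (hh₁bd : ∃ δ₀ > (0:ℝ), ∀ x : ℝ, |x| < δ₀ → |h₁ x| ≤ C₀ * |x| ^ (m + 1))
    (hh₂bd : ∃ δ₀ > (0:ℝ), ∀ x : ℝ, |x| < δ₀ → |h₂ x| ≤ C₀ * |x| ^ (n + 1)) :
    ∃ δ > (0:ℝ), δ ≤ 1 ∧ ∀ x y : ℝ, ‖((x, y) : ℝ × ℝ)‖ < δ →
      |b * x ^ n * y + y ^ 2 * B x y + h₁ x + y * h₂ x| ≤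
        (|b| + 3 * |C₀|) * ‖((x, y) : ℝ × ℝ)‖ ^ (m + 1) := by
  obtain ⟨δB, hδB, hB⟩ := hBbd
  obtain ⟨δ₁, hδ₁, hh₁⟩ := hh₁bd
  obtain ⟨δ₂, hδ₂, hh₂⟩ := hh₂bd
  refine ⟨min 1 (min δB (min δ₁ δ₂)), by positivity, min_le_left _ _, ?_⟩
  intro x y hxy
  obtain ⟨hr1, hrB, hr₁, hr₂⟩ : ‖((x, y) : ℝ × ℝ)‖ < 1 ∧ ‖((x, y) : ℝ × ℝ)‖ < δB ∧
      ‖((x, y) : ℝ × ℝ)‖ < δ₁ ∧ ‖((x, y) : ℝ × ℝ)‖ < δ₂ := by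
    simpa only [lt_min_iff] using hxy
  have hB' := hB x y hrB
  have hx : |x| ≤ ‖((x, y) : ℝ × ℝ)‖ := norm_fst_le (x, y)
  have hy : |y| ≤ ‖((x, y) : ℝ × ℝ)‖ := norm_snd_le (x, y)
  have hh₁' := hh₁ x (hx.trans_lt hr₁)
  have hh₂' := hh₂ x (hx.trans_lt hr₂)
  have hr0 := norm_nonneg ((x, y) : ℝ × ℝ)
  generalize ‖((x, y) : ℝ × ℝ)‖ = r at *
  have hpow : ∀ k, m + 1 ≤ k → r ^ k ≤ r ^ (m + 1) := fun k hk =>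
    pow_le_pow_of_le_one hr0 hr1.le hk
  have hC := le_abs_self C₀
  rw [max_eq_right hmn.le, Nat.add_sub_cancel] at hB'
  have e1 : |b * x ^ n * y| ≤ |b| * r ^ (m + 1) := by
    calc |b * x ^ n * y| = |b| * (|x| ^ n * |y|) := by rw [abs_mul, abs_mul, abs_pow, mul_assoc]
      _ ≤ |b| * (r ^ n * r) := by gcongr
      _ = |b| * r ^ (n + 1) := by rw [pow_succ]
      _ ≤ _ := by gcongr |b| * ?_; exact hpow _ (by omega)
  have e2 : |y ^ 2 * B x y| ≤ |C₀| * r ^ (m + 1) := by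
    calc |y ^ 2 * B x y| = |y| ^ 2 * |B x y| := by rw [abs_mul, abs_pow]
      _ ≤ r ^ 2 * (|C₀| * r ^ n) := by
          gcongr
          exact hB'.trans (by gcongr)
      _ = |C₀| * r ^ (n + 2) := by ring
      _ ≤ _ := by gcongr |C₀| * ?_; exact hpow _ (by omega)
  have e3 : |h₁ x| ≤ |C₀| * r ^ (m + 1) := hh₁'.trans (by gcongr)
  have e4 : |y * h₂ x| ≤ |C₀| * r ^ (m + 1) := by
    calc |y * h₂ x| = |y| * |h₂ x| := abs_mul _ _
      _ ≤ r * (|C₀| * r ^ (n + 1)) := by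
          gcongr
          exact hh₂'.trans (by gcongr)
      _ = |C₀| * r ^ (n + 2) := by ring
      _ ≤ _ := by gcongr |C₀| * ?_; exact hpow _ (by omega)
  have t1 := abs_add_le (b * x ^ n * y + y ^ 2 * B x y + h₁ x) (y * h₂ x)
  have t2 := abs_add_le (b * x ^ n * y + y ^ 2 * B x y) (h₁ x)
  have t3 := abs_add_le (b * x ^ n * y) (y ^ 2 * B x y)
  linarith

/-- A planar field `(y, a * x ^ m + O(‖(x, y)‖ ^ (m + 1)))` grows at most linearly near `0`. -/
lemma nilpotent_field_norm_le {a K δ : ℝ} {m : ℕ} (hm : 2 ≤ m) (hK : 0 ≤ K) (hδ1 : δ ≤ 1)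
    {F : ℝ × ℝ → ℝ × ℝ} {G : ℝ → ℝ → ℝ} (hF : ∀ x y, F (x, y) = (y, a * x ^ m + G x y))
    (hG : ∀ x y : ℝ, ‖((x, y) : ℝ × ℝ)‖ < δ →
      |G x y| ≤ K * ‖((x, y) : ℝ × ℝ)‖ ^ (m + 1)) :
    ∀ q, ‖q‖ < δ → ‖F q‖ ≤ (1 + |a| + K) * ‖q‖ := by
  rintro ⟨x, y⟩ hq
  have hx : |x| ≤ ‖((x, y) : ℝ × ℝ)‖ := norm_fst_le (x, y)
  have hy : |y| ≤ ‖((x, y) : ℝ × ℝ)‖ := norm_snd_le (x, y)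
  have hg := hG x y hq
  have hr0 := norm_nonneg ((x, y) : ℝ × ℝ)
  rw [hF, Prod.norm_mk]
  generalize ‖((x, y) : ℝ × ℝ)‖ = r at *
  have hpow : ∀ k, 1 ≤ k → r ^ k ≤ r := fun k hk =>
    pow_le_of_le_one hr0 (hq.le.trans hδ1) (by omega)
  have e1 : |a * x ^ m| ≤ |a| * r := by
    rw [abs_mul, abs_pow]
    gcongr
    exact (pow_le_pow_left₀ (abs_nonneg x) hx m).trans (hpow m (by omega))
  have e2 : |G x y| ≤ K * r := hg.trans (by gcongr; exact hpow _ (by omega))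
  have ha := mul_nonneg (abs_nonneg a) hr0
  have hKr := mul_nonneg hK hr0
  refine max_le ?_ ?_
  · rw [Real.norm_eq_abs]
    linarith
  · rw [Real.norm_eq_abs]
    linarith [abs_add_le (a * x ^ m) (G x y)]

/-- Taylor expansion of the unit-time map of a nilpotent singularity,
case `m < n + 1`. -/
theorem unit_time_map_expansion_m_lt_n_add_one
    (a b : ℝ) (ha : a ≠ 0) (hb : b ≠ 0)
    (m n : ℕ) (hm : 2 ≤ m) (hn : 1 ≤ n) (hmn : m < n + 1)
    (B : ℝ → ℝ → ℝ) (hB : ContDiff ℝ (⊤ : ℕ∞) (Function.uncurry B))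
    (h₁ h₂ : ℝ → ℝ) (hh₁ : ContDiff ℝ (⊤ : ℕ∞) h₁) (hh₂ : ContDiff ℝ (⊤ : ℕ∞) h₂)
    (C₀ : ℝ)
    (hBbd : ∃ δ₀ > (0:ℝ), ∀ x y : ℝ, ‖((x, y) : ℝ × ℝ)‖ < δ₀ →
      |B x y| ≤ C₀ * ‖((x, y) : ℝ × ℝ)‖ ^ (max m (n + 1) - 1))
    (hh₁bd : ∃ δ₀ > (0:ℝ), ∀ x : ℝ, |x| < δ₀ → |h₁ x| ≤ C₀ * |x| ^ (m + 1))
    (hh₂bd : ∃ δ₀ > (0:ℝ), ∀ x : ℝ, |x| < δ₀ → |h₂ x| ≤ C₀ * |x| ^ (n + 1))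
    (F : ℝ × ℝ → ℝ × ℝ)
    (hF : ∀ x y : ℝ, F (x, y) =
      (y, a * x ^ m + b * x ^ n * y + y ^ 2 * B x y + h₁ x + y * h₂ x))
    (U : Set (ℝ × ℝ)) (hU : U ∈ 𝓝 (0 : ℝ × ℝ))
    (φ : ℝ × ℝ → ℝ × ℝ) (hφ : IsTime1Map F U φ) :
    ∃ c d : ℕ → ℝ, ∃ C δ : ℝ, 0 < C ∧ 0 < δ ∧
      ∀ x y : ℝ, ‖((x, y) : ℝ × ℝ)‖ < δ →
        |(φ (x, y)).1 - (x + y + a / 2 * x ^ m +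
            a * ∑ i ∈ Finset.Icc 1 m, c i * x ^ (m - i) * y ^ i)| ≤
          C * ‖((x, y) : ℝ × ℝ)‖ ^ (m + 1) ∧
        |(φ (x, y)).2 - (y + a * x ^ m +
            a * ∑ i ∈ Finset.Icc 1 m, d i * x ^ (m - i) * y ^ i)| ≤
          C * ‖((x, y) : ℝ × ℝ)‖ ^ (m + 1) := by
  obtain ⟨δ₁, hδ₁, hδ₁1, hG⟩ := nilpotent_perturbation_bound (b := b) hmn hBbd hh₁bd hh₂bd
  obtain ⟨δ₂, hδ₂, hδ₂U⟩ := Metric.mem_nhds_iff.1 hU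
  set K := |b| + 3 * |C₀|
  have hK : 0 ≤ K := by positivity
  have hF' : ∀ x y, F (x, y) = (y, a * x ^ m +
      (b * x ^ n * y + y ^ 2 * B x y + h₁ x + y * h₂ x)) := by
    intro x y
    rw [hF]
    congr 1
    ring
  have hFL := nilpotent_field_norm_le hm hK hδ₁1 hF' hG
  set M := Real.exp (1 + |a| + K + 1)
  have hM : 0 < M := Real.exp_pos _
  set D := |a| * ((|a| + K) * m * 2 ^ (m - 1)) + K
  have hD : 0 ≤ D := by positivity
  refine ⟨fun i => (m.choose i : ℝ) / ((i + 1) * (i + 2)), fun i => (m.choose i : ℝ) / (i + 1),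
    D * M ^ (m + 1) + 1, min δ₂ (δ₁ / M), by positivity, by positivity, ?_⟩
  intro x y hxy
  obtain ⟨γ, hγ0, hγ, hφγ⟩ := hφ (x, y) (hδ₂U (by
    simpa using hxy.trans_le (min_le_left _ _)))
  have hRδ : M * ‖((x, y) : ℝ × ℝ)‖ < δ₁ := by
    rw [mul_comm]
    exact (lt_div_iff₀ hM).1 (hxy.trans_le (min_le_right _ _))
  have hbound := norm_le_exp_mul_of_norm_deriv_le_near (by positivity) hFL hγ (by rwa [hγ0])
  rw [hγ0] at hbound
  have hderiv : ∀ t ∈ Icc (0 : ℝ) 1, F (γ t) = ((γ t).2, a * (γ t).1 ^ m +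
      (b * (γ t).1 ^ n * (γ t).2 + (γ t).2 ^ 2 * B (γ t).1 (γ t).2 + h₁ (γ t).1 +
        (γ t).2 * h₂ (γ t).1)) := fun t _ => hF' (γ t).1 (γ t).2
  have key := nilpotent_curve_expansion (a := a) (K := K) (R := M * ‖((x, y) : ℝ × ℝ)‖) hm hK
    (by positivity) (hRδ.le.trans hδ₁1) (u := fun t => (γ t).1) (v := fun t => (γ t).2)
    (g := fun t => b * (γ t).1 ^ n * (γ t).2 + (γ t).2 ^ 2 * B (γ t).1 (γ t).2 + h₁ (γ t).1 +
      (γ t).2 * h₂ (γ t).1)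
    (fun t ht => by
      have h := hγ t ht
      rw [hderiv t ht] at h
      exact h.fst)
    (fun t ht => by
      have h := hγ t ht
      rw [hderiv t ht] at h
      exact h.snd)
    (fun t ht => (norm_fst_le (γ t)).trans (hbound t ht))
    (fun t ht => (norm_snd_le (γ t)).trans (hbound t ht))
    (fun t ht => (hG (γ t).1 (γ t).2 ((hbound t ht).trans_lt hRδ)).trans (by
      gcongr
      exact hbound t ht))
  simp only [hγ0, ← hφγ, linePowPrimitive_one, linePowSecondPrimitive_one] at key
  have hfinal : D * (M * ‖((x, y) : ℝ × ℝ)‖) ^ (m + 1) ≤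
      (D * M ^ (m + 1) + 1) * ‖((x, y) : ℝ × ℝ)‖ ^ (m + 1) := by
    rw [mul_pow, ← mul_assoc]
    gcongr
    linarith
  refine ⟨(Eq.trans_le ?_ key.1).trans hfinal, (Eq.trans_le ?_ key.2).trans hfinal⟩
  · congr 1
    ring
  · congr 1
    ring
end

section
/- Consider the planar vector field F(x, y) = (y, a x^m + b x^n y + y² B(x, y) + h₁(x) + y h₂(x)) with a ≠ 0, b ≠ 0, m, n ∈ ℕ, m ≥ 2, n ≥ 1, and m = n + 1, where B is smooth with |B(x, y)| ≤ C₀‖(x, y)‖^{max{m, n+1} − 1} near the origin and h₁, h₂ are smooth with |h₁(x)| ≤ C₀|x|^{m+1} and |h₂(x)| ≤ C₀|x|^{n+1} near 0. Let φ = (φ₁, φ₂) be a time-1 map of F on a neighborhood U of the origin. Then there exist real constants c₁, …, c_m, d₁, …, d_m (depending on m, a, b) and C, δ > 0 such that for all ‖(x, y)‖ < δ: |φ₁(x, y) − (x + y + (a/2)x^m + Σ_{i=1}^{m} c_i x^{m−i} y^i)| ≤ C‖(x, y)‖^{m+1} and |φ₂(x, y) − (y + a x^m + Σ_{i=1}^{m}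 d_i x^{m−i} y^i)| ≤ C‖(x, y)‖^{m+1}. -/
open MeasureTheory Filter Metric Set Topology

/-- The `t`-primitive, vanishing at `0`, of `(x + t * y) ^ N`. -/
noncomputable def binomialPrimitive (N : ℕ) (x y t : ℝ) : ℝ :=
  ∑ i ∈ Finset.range (N + 1), (N.choose i : ℝ) * x ^ (N - i) * y ^ i * (t ^ (i + 1) / (i + 1))

/-- The second `t`-primitive, vanishing to order two at `0`, of `(x + t * y) ^ N`. -/
noncomputable def binomialPrimitiveTwo (N : ℕ) (x y t : ℝ) : ℝ :=
  ∑ i ∈ Finset.range (N + 1),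
    (N.choose i : ℝ) * x ^ (N - i) * y ^ i * (t ^ (i + 2) / ((i + 1) * (i + 2)))

lemma hasDerivAt_binomialPrimitive (N : ℕ) (x y t : ℝ) :
    HasDerivAt (binomialPrimitive N x y) ((x + t * y) ^ N) t := by
  have hsum : (x + t * y) ^ N = ∑ i ∈ Finset.range (N + 1),
      (N.choose i : ℝ) * x ^ (N - i) * y ^ i * t ^ i := by
    rw [add_comm, add_pow]
    refine Finset.sum_congr rfl fun i _ => ?_
    rw [mul_pow]
    ring
  rw [hsum]
  refine HasDerivAt.fun_sum fun i _ => HasDerivAt.const_mul _ ?_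
  have hi : (i : ℝ) + 1 ≠ 0 := by positivity
  convert (hasDerivAt_pow (i + 1) t).div_const ((i : ℝ) + 1) using 1
  push_cast
  field_simp

lemma hasDerivAt_binomialPrimitiveTwo (N : ℕ) (x y t : ℝ) :
    HasDerivAt (binomialPrimitiveTwo N x y) (binomialPrimitive N x y t) t := by
  refine HasDerivAt.fun_sum fun i _ => HasDerivAt.const_mul _ ?_
  have hi : (i : ℝ) + 1 ≠ 0 := by positivity
  have hi' : (i : ℝ) + 2 ≠ 0 := by positivity
  convert (hasDerivAt_pow (i + 2) t).div_const (((i : ℝ) + 1) * (i + 2)) using 1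
  push_cast
  field_simp

lemma binomialPrimitive_zero (N : ℕ) (x y : ℝ) : binomialPrimitive N x y 0 = 0 := by
  simp [binomialPrimitive]

lemma binomialPrimitiveTwo_zero (N : ℕ) (x y : ℝ) : binomialPrimitiveTwo N x y 0 = 0 := by
  simp [binomialPrimitiveTwo]

/-- A weighted binomial sum of degree `n + 1` plus `y` times one of degree `n`, split into its
leading term in `x` and a form divisible by `y`. -/
lemma weighted_binomial_sum_split (n : ℕ) (a b x y : ℝ) (w : ℕ → ℝ) :
    a * ∑ i ∈ Finset.range (n + 1 + 1), ((n + 1).choose i : ℝ) * x ^ (n + 1 - i) * y ^ i * w i +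
      b * (∑ i ∈ Finset.range (n + 1), (n.choose i : ℝ) * x ^ (n - i) * y ^ i * w i) * y =
    a * w 0 * x ^ (n + 1) + ∑ i ∈ Finset.Icc 1 (n + 1),
      (a * (n + 1).choose i * w i + b * n.choose (i - 1) * w (i - 1)) * x ^ (n + 1 - i) * y ^ i := by
  have hIcc : Finset.Icc 1 (n + 1) = Finset.Ico 1 (n + 1 + 1) := by
    ext
    simp only [Finset.mem_Icc, Finset.mem_Ico]
    omega
  rw [hIcc, Finset.sum_Ico_eq_sum_range, Finset.sum_range_succ' _ (n + 1), mul_add, Finset.mul_sum,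
    Finset.mul_sum, Finset.sum_mul, add_right_comm, ← Finset.sum_add_distrib, add_comm]
  congr 1
  · simp only [Nat.choose_zero_right, Nat.sub_zero]
    push_cast
    ring
  · refine Finset.sum_congr rfl fun i _ => ?_
    rw [add_comm 1 i, Nat.add_sub_cancel, Nat.add_sub_add_right]
    ring

lemma abs_sub_le_of_abs_deriv_le {f f' : ℝ → ℝ} {K : ℝ}
    (hf : ∀ t ∈ Icc (0 : ℝ) 1, HasDerivAt f (f' t) t)
    (hK : ∀ t ∈ Icc (0 : ℝ) 1, |f' t| ≤ K) {t : ℝ} (ht : t ∈ Icc (0 : ℝ) 1) :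
    |f t - f 0| ≤ K := by
  have h := norm_image_sub_le_of_norm_deriv_le_segment'
    (fun s hs => (hf s hs).hasDerivWithinAt) (fun s hs => hK s (Ico_subset_Icc_self hs)) t ht
  have hK0 : 0 ≤ K := (abs_nonneg _).trans (hK t ht)
  rw [Real.norm_eq_abs] at h
  nlinarith [ht.2]

/-- An integral curve of a field with `‖F p‖ ≤ K * ‖p‖` near the origin that starts close enough
to the origin stays there up to time `1`, with a linear bound. -/
lemma norm_integralCurve_le {E : Type*} [NormedAddCommGroup E] [NormedSpace ℝ E]
    {F : E → E} {K ρ : ℝ} (hK : 0 ≤ K) (hF : ∀ p, ‖p‖ < ρ → ‖F p‖ ≤ K * ‖p‖)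
    {γ : ℝ → E} (hγ : ∀ t ∈ Icc (0 : ℝ) 1, HasDerivAt γ (F (γ t)) t)
    (h0 : Real.exp (K + 1) * ‖γ 0‖ < ρ) {t : ℝ} (ht : t ∈ Icc (0 : ℝ) 1) :
    ‖γ t‖ ≤ Real.exp (K + 1) * ‖γ 0‖ := by
  have hL : 0 < Real.exp (K + 1) := Real.exp_pos _
  refine le_of_forall_gt_imp_ge_of_dense fun s hs => ?_
  wlog hsρ : s < ρ generalizing s
  · obtain ⟨s', h1, h2⟩ := exists_between h0
    exact (this s' h1 h2).trans (h2.le.trans (not_lt.1 hsρ))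
  set r := s / Real.exp (K + 1) with hr
  have hrs : r * Real.exp (K + 1) = s := by rw [hr]; field_simp
  have hr0 : ‖γ 0‖ < r := by rw [hr, lt_div_iff₀ hL]; linarith
  have hrpos : 0 < r := (norm_nonneg _).trans_lt hr0
  have hle : ∀ u ∈ Icc (0 : ℝ) 1, r * Real.exp ((K + 1) * u) ≤ s := by
    intro u hu
    rw [← hrs]
    gcongr
    nlinarith [hu.2]
  refine (image_norm_le_of_norm_deriv_right_lt_deriv_boundary
    (f := γ) (f' := fun u => F (γ u)) (B := fun u => r * Real.exp ((K + 1) * u))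
    (B' := fun u => r * (Real.exp ((K + 1) * u) * (K + 1)))
    (fun u hu => (hγ u hu).continuousAt.continuousWithinAt)
    (fun u hu => (hγ u (Ico_subset_Icc_self hu)).hasDerivWithinAt) (by simpa using hr0.le)
    (fun u => ?_) (fun u hu hu' => ?_) ht).trans (hle t ht)
  · simpa using (((hasDerivAt_id u).const_mul (K + 1)).exp).const_mul r
  · have h1 := hle u (Ico_subset_Icc_self hu)
    have h2 := hF (γ u) (by rw [hu']; linarith)
    have h3 : 0 < r * Real.exp ((K + 1) * u) := by positivity
    rw [hu'] at h2
    nlinarith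

/-- The expansion at time `1` of an integral curve of `(y, g)`, where `g` is a perturbation of order
`n + 2` of `a * x ^ (n + 1) + b * x ^ n * y`. -/
lemma nilpotent_integralCurve_expansion {a b A s : ℝ} {n : ℕ} (hn : 1 ≤ n)
    {x y g : ℝ → ℝ}
    (hx : ∀ t ∈ Icc (0 : ℝ) 1, HasDerivAt x (y t) t)
    (hy : ∀ t ∈ Icc (0 : ℝ) 1, HasDerivAt y (g t) t)
    (hs : s ≤ 1) (hA : 0 ≤ A)
    (hxs : ∀ t ∈ Icc (0 : ℝ) 1, |x t| ≤ s) (hys : ∀ t ∈ Icc (0 : ℝ) 1, |y t| ≤ s)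
    (hg : ∀ t ∈ Icc (0 : ℝ) 1,
      |g t - (a * x t ^ (n + 1) + b * x t ^ n * y t)| ≤ A * s ^ (n + 2)) :
    let M := |a| + |b| + A
    let D := |a| * (M * (n + 1) * 2 ^ n) + |b| * (M + M * n * 2 ^ (n - 1)) + A
    |x 1 - (x 0 + y 0 + (a * binomialPrimitiveTwo (n + 1) (x 0) (y 0) 1 +
        b * binomialPrimitiveTwo n (x 0) (y 0) 1 * y 0))| ≤ D * s ^ (n + 2) ∧
    |y 1 - (y 0 + (a * binomialPrimitive (n + 1) (x 0) (y 0) 1 +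
        b * binomialPrimitive n (x 0) (y 0) 1 * y 0))| ≤ D * s ^ (n + 2) := by
  intro M D
  have h01 : (0 : ℝ) ∈ Icc (0 : ℝ) 1 := by simp
  have h11 : (1 : ℝ) ∈ Icc (0 : ℝ) 1 := by simp
  have hs0 : 0 ≤ s := (abs_nonneg _).trans (hxs 0 h01)
  have hM : 0 ≤ M := by positivity
  have hgM : ∀ t ∈ Icc (0 : ℝ) 1, |g t| ≤ M * s ^ (n + 1) := by
    intro t ht
    have h1 : |a * x t ^ (n + 1) + b * x t ^ n * y t| ≤ |a| * s ^ (n + 1) + |b| * s ^ n * s := by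
      refine (abs_add_le _ _).trans ?_
      simp only [abs_mul, abs_pow]
      gcongr
      exacts [hxs t ht, hxs t ht, hys t ht]
    have h2 : A * s ^ (n + 2) ≤ A * s ^ (n + 1) := by
      gcongr ?_ * ?_
      exact pow_le_pow_of_le_one hs0 hs (by omega)
    have h3 := abs_sub_abs_le_abs_sub (g t) (a * x t ^ (n + 1) + b * x t ^ n * y t)
    have h4 := hg t ht
    simp only [M]
    linear_combination h1 + h2 + h3 + h4
  have hy1 : ∀ t ∈ Icc (0 : ℝ) 1, |y t - y 0| ≤ M * s ^ (n + 1) := fun t ht =>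
    abs_sub_le_of_abs_deriv_le hy hgM ht
  have hx1 : ∀ t ∈ Icc (0 : ℝ) 1, |x t - (x 0 + t * y 0)| ≤ M * s ^ (n + 1) := by
    intro t ht
    have h := abs_sub_le_of_abs_deriv_le (f := fun u => x u - u * y 0)
      (f' := fun u => y u - y 0)
      (fun u hu => by
        simpa only [one_mul] using! (hx u hu).sub ((hasDerivAt_id' u).mul_const (y 0))) hy1 ht
    convert h using 2
    ring
  have hZ : ∀ t ∈ Icc (0 : ℝ) 1, |x 0 + t * y 0| ≤ 2 * s := by
    intro t ht
    have h := abs_add_le (x 0) (t * y 0)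
    rw [abs_mul, abs_of_nonneg ht.1] at h
    nlinarith [hxs 0 h01, hys 0 h01, ht.2, abs_nonneg (y 0)]
  have hpow : ∀ k : ℕ, ∀ t ∈ Icc (0 : ℝ) 1, |x t ^ k - (x 0 + t * y 0) ^ k| ≤
      M * s ^ (n + 1) * k * (2 * s) ^ (k - 1) := by
    intro k t ht
    refine (abs_pow_sub_pow_le _ _ _).trans ?_
    gcongr
    · exact hx1 t ht
    · exact max_le (by linarith [hxs t ht]) (hZ t ht)
  have hg1 : ∀ t ∈ Icc (0 : ℝ) 1,
      |g t - (a * (x 0 + t * y 0) ^ (n + 1) + b * (x 0 + t * y 0) ^ n * y 0)| ≤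
        D * s ^ (n + 2) := by
    intro t ht
    set Z := x 0 + t * y 0
    have hsn : s ^ n ≤ s := by simpa using pow_le_pow_of_le_one hs0 hs hn
    have e1 : |a * (x t ^ (n + 1) - Z ^ (n + 1))| ≤
        |a| * (M * (n + 1) * 2 ^ n * s ^ (n + 2)) := by
      rw [abs_mul]
      gcongr
      refine (hpow (n + 1) t ht).trans ?_
      rw [Nat.add_sub_cancel, mul_pow]
      push_cast
      calc M * s ^ (n + 1) * (n + 1) * (2 ^ n * s ^ n)
          ≤ M * s ^ (n + 1) * (n + 1) * (2 ^ n * s) := by gcongr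
        _ = _ := by ring
    have e2 : |b * (x t ^ n * (y t - y 0))| ≤ |b| * (M * s ^ (n + 2)) := by
      rw [abs_mul, abs_mul, abs_pow]
      refine mul_le_mul_of_nonneg_left ?_ (abs_nonneg b)
      calc |x t| ^ n * |y t - y 0| ≤ s ^ n * (M * s ^ (n + 1)) := by
            gcongr
            exacts [hxs t ht, hy1 t ht]
        _ ≤ s * (M * s ^ (n + 1)) := by gcongr
        _ = _ := by ring
    have e3 : |b * ((x t ^ n - Z ^ n) * y 0)| ≤ |b| * (M * n * 2 ^ (n - 1) * s ^ (n + 2)) := by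
      rw [abs_mul, abs_mul]
      refine mul_le_mul_of_nonneg_left ?_ (abs_nonneg b)
      calc |x t ^ n - Z ^ n| * |y 0|
          ≤ (M * s ^ (n + 1) * n * (2 * s) ^ (n - 1)) * s := by
            gcongr
            exacts [hpow n t ht, hys 0 h01]
        _ ≤ (M * s ^ (n + 1) * n * (2 ^ (n - 1) * 1)) * s := by
            rw [mul_pow]
            gcongr
            exact pow_le_one₀ hs0 hs
        _ = _ := by ring
    have e4 := hg t ht
    have key : g t - (a * Z ^ (n + 1) + b * Z ^ n * y 0) =
        (g t - (a * x t ^ (n + 1) + b * x t ^ n * y t)) + a * (x t ^ (n + 1) - Z ^ (n + 1)) +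
          b * (x t ^ n * (y t - y 0)) + b * ((x t ^ n - Z ^ n) * y 0) := by ring
    rw [key]
    refine (abs_add_le _ _).trans ?_
    have h1 := abs_add_three (g t - (a * x t ^ (n + 1) + b * x t ^ n * y t))
      (a * (x t ^ (n + 1) - Z ^ (n + 1))) (b * (x t ^ n * (y t - y 0)))
    simp only [D]
    linear_combination h1 + e1 + e2 + e3 + e4
  have hy2 : ∀ t ∈ Icc (0 : ℝ) 1,
      |y t - (y 0 + (a * binomialPrimitive (n + 1) (x 0) (y 0) t +
        b * binomialPrimitive n (x 0) (y 0) t * y 0))| ≤ D * s ^ (n + 2) := by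
    intro t ht
    have h := abs_sub_le_of_abs_deriv_le
      (fun u hu => (hy u hu).sub (((hasDerivAt_binomialPrimitive (n + 1) (x 0) (y 0) u).const_mul
        a).add (((hasDerivAt_binomialPrimitive n (x 0) (y 0) u).const_mul b).mul_const (y 0))))
      hg1 ht
    convert h using 2
    simp only [Pi.sub_apply, Pi.add_apply, binomialPrimitive_zero]
    ring
  refine ⟨?_, hy2 1 h11⟩
  have h := abs_sub_le_of_abs_deriv_le
    (fun u hu => (hx u hu).sub (((hasDerivAt_id u).mul_const (y 0)).add
      (((hasDerivAt_binomialPrimitiveTwo (n + 1) (x 0) (y 0) u).const_mul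
        a).add (((hasDerivAt_binomialPrimitiveTwo n (x 0) (y 0) u).const_mul b).mul_const (y 0)))))
    (fun t ht => by simpa only [one_mul] using hy2 t ht) h11
  convert h using 2
  simp only [Pi.sub_apply, Pi.add_apply, binomialPrimitiveTwo_zero, id]
  ring

/-- Taylor expansion of the unit-time map of a nilpotent singularity,
case `m = n + 1`. -/
theorem unit_time_map_expansion_m_eq_n_add_one
    (a b : ℝ) (ha : a ≠ 0) (hb : b ≠ 0)
    (m n : ℕ) (hm : 2 ≤ m) (hn : 1 ≤ n) (hmn : m = n + 1)
    (B : ℝ → ℝ → ℝ) (hB : ContDiff ℝ (⊤ : ℕ∞) (Function.uncurry B))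
    (h₁ h₂ : ℝ → ℝ) (hh₁ : ContDiff ℝ (⊤ : ℕ∞) h₁) (hh₂ : ContDiff ℝ (⊤ : ℕ∞) h₂)
    (C₀ : ℝ)
    (hBbd : ∃ δ₀ > (0:ℝ), ∀ x y : ℝ, ‖((x, y) : ℝ × ℝ)‖ < δ₀ →
      |B x y| ≤ C₀ * ‖((x, y) : ℝ × ℝ)‖ ^ (max m (n + 1) - 1))
    (hh₁bd : ∃ δ₀ > (0:ℝ), ∀ x : ℝ, |x| < δ₀ → |h₁ x| ≤ C₀ * |x| ^ (m + 1))
    (hh₂bd : ∃ δ₀ > (0:ℝ), ∀ x : ℝ, |x| < δ₀ → |h₂ x| ≤ C₀ * |x| ^ (n + 1))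
    (F : ℝ × ℝ → ℝ × ℝ)
    (hF : ∀ x y : ℝ, F (x, y) =
      (y, a * x ^ m + b * x ^ n * y + y ^ 2 * B x y + h₁ x + y * h₂ x))
    (U : Set (ℝ × ℝ)) (hU : U ∈ 𝓝 (0 : ℝ × ℝ))
    (φ : ℝ × ℝ → ℝ × ℝ) (hφ : IsTime1Map F U φ) :
    ∃ c d : ℕ → ℝ, ∃ C δ : ℝ, 0 < C ∧ 0 < δ ∧
      ∀ x y : ℝ, ‖((x, y) : ℝ × ℝ)‖ < δ →
        |(φ (x, y)).1 - (x + y + a / 2 * x ^ m +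
            ∑ i ∈ Finset.Icc 1 m, c i * x ^ (m - i) * y ^ i)| ≤
          C * ‖((x, y) : ℝ × ℝ)‖ ^ (m + 1) ∧
        |(φ (x, y)).2 - (y + a * x ^ m +
            ∑ i ∈ Finset.Icc 1 m, d i * x ^ (m - i) * y ^ i)| ≤
          C * ‖((x, y) : ℝ × ℝ)‖ ^ (m + 1) := by
  subst hmn
  obtain ⟨δB, hδB, hBbd⟩ := hBbd
  obtain ⟨δ₁, hδ₁, hh₁bd⟩ := hh₁bd
  obtain ⟨δ₂, hδ₂, hh₂bd⟩ := hh₂bd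
  obtain ⟨δU, hδU, hUball⟩ := Metric.mem_nhds_iff.1 hU
  set ρ : ℝ := min 1 (min δB (min δ₁ δ₂))
  have hρ0 : 0 < ρ := by positivity
  have hρ1 : ρ ≤ 1 := min_le_left _ _
  have hρB : ρ ≤ δB := (min_le_right _ _).trans (min_le_left _ _)
  have hρ₁ : ρ ≤ δ₁ := (min_le_right _ _).trans ((min_le_right _ _).trans (min_le_left _ _))
  have hρ₂ : ρ ≤ δ₂ := (min_le_right _ _).trans ((min_le_right _ _).trans (min_le_right _ _))
  set A : ℝ := 3 * |C₀|
  have hA : 0 ≤ A := by positivity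
  have hrem : ∀ p : ℝ × ℝ, ‖p‖ < ρ →
      |(F p).2 - (a * p.1 ^ (n + 1) + b * p.1 ^ n * p.2)| ≤ A * ‖p‖ ^ (n + 2) := by
    rintro ⟨x, y⟩ hp
    set r := ‖((x, y) : ℝ × ℝ)‖
    have hxr : |x| ≤ r := norm_fst_le (x, y)
    have hyr : |y| ≤ r := norm_snd_le (x, y)
    have hr0 : 0 ≤ r := norm_nonneg _
    have hC := le_abs_self C₀
    have e1 : |y ^ 2 * B x y| ≤ |C₀| * r ^ (n + 2) := by
      have h := hBbd x y (hp.trans_le hρB)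
      rw [max_self, Nat.add_sub_cancel] at h
      rw [abs_mul, abs_pow]
      calc |y| ^ 2 * |B x y| ≤ r ^ 2 * (|C₀| * r ^ n) := by
            gcongr
            exact h.trans (by gcongr)
        _ = _ := by ring
    have e2 : |h₁ x| ≤ |C₀| * r ^ (n + 2) := by
      refine (hh₁bd x (hxr.trans_lt (hp.trans_le hρ₁))).trans ?_
      gcongr
    have e3 : |y * h₂ x| ≤ |C₀| * r ^ (n + 2) := by
      have h := hh₂bd x (hxr.trans_lt (hp.trans_le hρ₂))
      rw [abs_mul]
      calc |y| * |h₂ x| ≤ r * (|C₀| * r ^ (n + 1)) := by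
            gcongr
            exact h.trans (by gcongr)
        _ = _ := by ring
    have h3 := abs_add_three (y ^ 2 * B x y) (h₁ x) (y * h₂ x)
    rw [hF]
    calc _ = |y ^ 2 * B x y + h₁ x + y * h₂ x| := by
          congr 1
          ring
      _ ≤ _ := by linarith
  set K : ℝ := 1 + |a| + |b| + A
  have hK : 0 ≤ K := by positivity
  have hFK : ∀ p : ℝ × ℝ, ‖p‖ < ρ → ‖F p‖ ≤ K * ‖p‖ := by
    intro p hp
    have h := hrem p hp
    set r := ‖p‖
    have hr0 : 0 ≤ r := norm_nonneg _
    have hr1 : r ≤ 1 := hp.le.trans hρ1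
    have hpr : ∀ k : ℕ, 1 ≤ k → r ^ k ≤ r := fun k hk => by
      simpa using pow_le_pow_of_le_one hr0 hr1 hk
    have hxr : |p.1| ≤ r := norm_fst_le p
    have hyr : |p.2| ≤ r := norm_snd_le p
    have h1 : |a * p.1 ^ (n + 1) + b * p.1 ^ n * p.2| ≤ |a| * r + |b| * r := by
      refine (abs_add_le _ _).trans ?_
      simp only [abs_mul, abs_pow]
      calc |a| * |p.1| ^ (n + 1) + |b| * |p.1| ^ n * |p.2|
          ≤ |a| * r ^ (n + 1) + |b| * r ^ n * r := by gcongr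
        _ = |a| * r ^ (n + 1) + |b| * r ^ (n + 1) := by ring
        _ ≤ _ := by
          gcongr <;> exact hpr _ (by omega)
    have h2 : A * r ^ (n + 2) ≤ A * r := by
      gcongr
      exact hpr _ (by omega)
    have h3 := abs_sub_abs_le_abs_sub (F p).2 (a * p.1 ^ (n + 1) + b * p.1 ^ n * p.2)
    have hF1 : (F p).1 = p.2 := by
      rw [← Prod.mk.eta (p := p), hF]
    rw [norm_prod_le_iff, Real.norm_eq_abs, Real.norm_eq_abs, hF1]
    have h4 : 0 ≤ (|a| + |b| + A) * r := by positivity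
    constructor <;> nlinarith
  set L : ℝ := Real.exp (K + 1)
  have hL : 0 < L := Real.exp_pos _
  set M : ℝ := |a| + |b| + A
  set D : ℝ := |a| * (M * (n + 1) * 2 ^ n) + |b| * (M + M * n * 2 ^ (n - 1)) + A
  have hD0 : 0 ≤ D := by positivity
  refine ⟨fun i => a * (n + 1).choose i * (1 / (((i : ℕ) + 1) * ((i : ℕ) + 2))) +
      b * n.choose (i - 1) * (1 / (((i - 1 : ℕ) + 1) * ((i - 1 : ℕ) + 2))),
    fun i => a * (n + 1).choose i * (1 / ((i : ℕ) + 1)) +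
      b * n.choose (i - 1) * (1 / ((i - 1 : ℕ) + 1)),
    D * L ^ (n + 2) + 1, min δU (ρ / L), by positivity, by positivity, fun x y hxy => ?_⟩
  have hxU : (x, y) ∈ U := hUball (by
    rw [mem_ball_zero_iff]
    exact hxy.trans_le (min_le_left _ _))
  obtain ⟨γ, hγ0, hγ, hφγ⟩ := hφ (x, y) hxU
  have hstart : L * ‖γ 0‖ < ρ := by
    rw [hγ0, mul_comm, ← lt_div_iff₀ hL]
    exact hxy.trans_le (min_le_right _ _)
  have hγle : ∀ t ∈ Icc (0 : ℝ) 1, ‖γ t‖ ≤ L * ‖γ 0‖ := fun t ht =>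
    norm_integralCurve_le hK hFK hγ hstart ht
  have hγ1 : ∀ t, (F (γ t)).1 = (γ t).2 := fun t => by
    rw [← Prod.mk.eta (p := γ t), hF]
  have hexp := nilpotent_integralCurve_expansion (a := a) (b := b) hn
    (x := fun t => (γ t).1) (y := fun t => (γ t).2) (g := fun t => (F (γ t)).2)
    (fun t ht => hγ1 t ▸ (hasFDerivAt_fst (𝕜 := ℝ) (p := γ t)).comp_hasDerivAt t (hγ t ht))
    (fun t ht => (hasFDerivAt_snd (𝕜 := ℝ) (p := γ t)).comp_hasDerivAt t (hγ t ht))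
    (hstart.le.trans hρ1) hA
    (fun t ht => (norm_fst_le (γ t)).trans (hγle t ht))
    (fun t ht => (norm_snd_le (γ t)).trans (hγle t ht))
    (fun t ht => (hrem (γ t) ((hγle t ht).trans_lt hstart)).trans (by
      gcongr
      exact hγle t ht))
  simp only [hγ0, ← hφγ, binomialPrimitive, binomialPrimitiveTwo, one_pow] at hexp
  rw [weighted_binomial_sum_split n a b x y fun i => 1 / (((i : ℕ) + 1) * ((i : ℕ) + 2)),
    weighted_binomial_sum_split n a b x y fun i => 1 / ((i : ℕ) + 1)] at hexp
  have hbound : D * (L * ‖((x, y) : ℝ × ℝ)‖) ^ (n + 2) ≤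
      (D * L ^ (n + 2) + 1) * ‖((x, y) : ℝ × ℝ)‖ ^ (n + 1 + 1) := by
    have : 0 ≤ ‖((x, y) : ℝ × ℝ)‖ ^ (n + 2) := by positivity
    rw [mul_pow]
    linarith
  refine ⟨le_trans (le_of_eq ?_) (hexp.1.trans hbound),
    le_trans (le_of_eq ?_) (hexp.2.trans hbound)⟩
  · congr 2
    norm_num
    ring
  · congr 2
    norm_num
    ring
end
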